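/- (Multi-component model, XXZ case.) Let H be a complex vector space, K ≥ 1, and for j = 1, …, K let Tⱼ(λ) = [[Aⱼ(λ),Bⱼ(λ)],[Cⱼ(λ),Dⱼ(λ)]] be monodromy matrices on H with common domain Λ ⊆ ℂ, each satisfying the RTT relation with the trigonometric (XXZ-type) R-matrix with anisotropy η, such that every matrix entry of Tᵢ(λ) commutes with every matrix entry of Tⱼ(μ) whenever i ≠ j. Suppose there is a nonzero vector |0⟩ ∈ H and scalar functions aⱼ, dⱼ : Λ → ℂ with Aⱼ(λ)|0⟩ = aⱼ(λ)|0⟩, Dⱼ(λ)|0⟩ = dⱼ(λ)|0⟩ and Cⱼ(λ)|0⟩ = 0 for all j and all λ ∈ Λ. Let B(λ) be the (1,2) entry of T(λ) = T₁(λ)T₂(λ)⋯T_K(λ). Then for any λ₁, …, λ_M ∈ Λ with sinh(λⱼ−λ_k) ≠ 0 for all j ≠ k: B(λ₁)⋯B(λ_M)|0⟩ = Σ ( ∏_{1≤i<j≤K} [ ( ∏_{k∈Jⱼ} aᵢ(λ_k) ) ( ∏_{k∈Jᵢ} dⱼ(λ_k) ) ( ∏_{k∈Jᵢ, l∈Jⱼ}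 f(λ_k,λ_l) ) ] ) ( ∏_{k∈J₁} B₁(λ_k) ) ⋯ ( ∏_{k∈J_K} B_K(λ_k) ) |0⟩, where f(λ,μ) = sinh(λ−μ+η)/sinh(λ−μ), the sum is over all ordered partitions of {1,…,M} into K pairwise disjoint (possibly empty) subsets J₁, …, J_K with union {1,…,M}, and within each factor ∏_{k∈Jⱼ} Bⱼ(λ_k) the order is irrelevant since [Bⱼ(λ),Bⱼ(μ)] = 0. -/

import Mathlib

open scoped BigOperators

noncomputable section

/-- The endomorphism algebra of a complex vector space `H`. -/
abbrev EndH (H : Type) [AddCommGroup H] [Module ℂ H] := Module.End ℂ H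

/-- The 4×4 matrix `[[f,0,0,0],[0,1,g,0],[0,g,1,0],[0,0,0,f]]` acting on `ℂ² ⊗ ℂ²`,
indexed by `Fin 2 × Fin 2` (standard tensor basis). -/
def Rfg (f g : ℂ) : Matrix (Fin 2 × Fin 2) (Fin 2 × Fin 2) ℂ :=
  fun p q =>
    if p = q then (if p.1 = p.2 then f else 1)
    else if p.1 = q.2 ∧ p.2 = q.1 then g else 0

/-- Rational function `f(λ,μ) = (λ-μ+1)/(λ-μ)`. -/
def fXXX (l m : ℂ) : ℂ := (l - m + 1) / (l - m)

/-- Rational function `g(λ,μ) = 1/(λ-μ)`. -/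
def gXXX (l m : ℂ) : ℂ := 1 / (l - m)

/-- The rational (XXX-type) R-matrix. -/
def RXXX (l m : ℂ) : Matrix (Fin 2 × Fin 2) (Fin 2 × Fin 2) ℂ := Rfg (fXXX l m) (gXXX l m)

/-- Trigonometric `f(λ,μ) = sinh(λ-μ+η)/sinh(λ-μ)`. -/
def fXXZ (η l m : ℂ) : ℂ := Complex.sinh (l - m + η) / Complex.sinh (l - m)

/-- Trigonometric `g(λ,μ) = sinh η / sinh(λ-μ)`. -/
def gXXZ (η l m : ℂ) : ℂ := Complex.sinh η / Complex.sinh (l - m)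

/-- The trigonometric (XXZ-type) R-matrix with anisotropy `η`. -/
def RXXZ (η l m : ℂ) : Matrix (Fin 2 × Fin 2) (Fin 2 × Fin 2) ℂ :=
  Rfg (fXXZ η l m) (gXXZ η l m)

variable {H : Type} [AddCommGroup H] [Module ℂ H]

/-- `T₁(λ)`: the 2×2 operator matrix `T` acting in the first auxiliary space `ℂ²`
(and in `H`), identity in the second auxiliary space. -/
def aux1 (T : Matrix (Fin 2) (Fin 2) (EndH H)) :
    Matrix (Fin 2 × Fin 2) (Fin 2 × Fin 2) (EndH H) :=
  fun p q => if p.2 = q.2 then T p.1 q.1 else 0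

/-- `T₂(μ)`: the 2×2 operator matrix `T` acting in the second auxiliary space `ℂ²`
(and in `H`), identity in the first auxiliary space. -/
def aux2 (T : Matrix (Fin 2) (Fin 2) (EndH H)) :
    Matrix (Fin 2 × Fin 2) (Fin 2 × Fin 2) (EndH H) :=
  fun p q => if p.1 = q.1 then T p.2 q.2 else 0

/-- A scalar 4×4 matrix viewed as a matrix of endomorphisms of `H`
(i.e. `R ⊗ id_H` on `ℂ² ⊗ ℂ² ⊗ H`). -/
def embedR (R : Matrix (Fin 2 × Fin 2) (Fin 2 × Fin 2) ℂ) :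
    Matrix (Fin 2 × Fin 2) (Fin 2 × Fin 2) (EndH H) :=
  R.map (fun c => c • (1 : EndH H))

/-- The RTT relation `R₁₂(λ,μ) T₁(λ) T₂(μ) = T₂(μ) T₁(λ) R₁₂(λ,μ)` in
`End(ℂ² ⊗ ℂ² ⊗ H)`, for all `λ, μ ∈ Λ` which are admissible (`adm λ μ`). -/
def SatisfiesRTT (Λ : Set ℂ) (adm : ℂ → ℂ → Prop)
    (R : ℂ → ℂ → Matrix (Fin 2 × Fin 2) (Fin 2 × Fin 2) ℂ)
    (T : ℂ → Matrix (Fin 2) (Fin 2) (EndH H)) : Prop :=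
  ∀ lam mu : ℂ, lam ∈ Λ → mu ∈ Λ → adm lam mu →
    embedR (R lam mu) * aux1 (T lam) * aux2 (T mu)
      = aux2 (T mu) * aux1 (T lam) * embedR (R lam mu)

/-- Ordered product `∏_{k ∈ s} B k` of endomorphisms indexed by a finset of a linearly
ordered type, taken in increasing order of the index. -/
def finsetOpProd {ι : Type} [LinearOrder ι] (s : Finset ι) (B : ι → EndH H) : EndH H :=
  ((s.sort (· ≤ ·)).map B).prod

section OperatorProducts

variable {ι : Type} [LinearOrder ι]

theorem finsetOpProd_empty (B : ι → EndH H) : finsetOpProd ∅ B = 1 := by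
  simp [finsetOpProd]

theorem finsetOpProd_insert_min {m : ι} {s : Finset ι} (hm : ∀ x ∈ s, m < x) (B : ι → EndH H) :
    finsetOpProd (insert m s) B = B m * finsetOpProd s B := by
  have hms : m ∉ s := fun h => lt_irrefl _ (hm m h)
  rw [finsetOpProd, Finset.sort_insert _ (fun b hb => (hm b hb).le) hms, List.map_cons,
    List.prod_cons, finsetOpProd]

theorem finsetOpProd_map {κ : Type} [LinearOrder κ] (e : κ ↪ ι) (he : StrictMono e)
    (s : Finset κ) (B : ι → EndH H) :
    finsetOpProd (s.map e) B = finsetOpProd s (fun k => B (e k)) := by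
  rw [finsetOpProd, ← StrictMonoOn.map_finsetSort e s (he.strictMonoOn _), finsetOpProd,
    List.map_map]
  rfl

theorem finsetOpProd_univ_coe (s : Finset ι) (B : ι → EndH H) :
    finsetOpProd (Finset.univ : Finset s) (fun k => B k) = finsetOpProd s B := by
  have := finsetOpProd_map (Function.Embedding.subtype (· ∈ s)) (Subtype.strictMono_coe _)
    Finset.univ B
  rw [show Finset.univ.map (Function.Embedding.subtype (· ∈ s)) = s from Finset.attach_map_val]
    at this
  exact this.symm

theorem commute_finsetOpProd {X : EndH H} {s : Finset ι} {B : ι → EndH H}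
    (h : ∀ k ∈ s, Commute X (B k)) : Commute X (finsetOpProd s B) := by
  refine Commute.list_prod_right _ _ fun Y hY => ?_
  obtain ⟨k, hk, rfl⟩ := List.mem_map.1 hY
  exact h k ((Finset.mem_sort _).1 hk)

/-- Action of an operator `E x` on an off-shell Bethe vector, given its exchange relations with
the creation operators. The creation operators are only assumed to commute up to the factor `f`,
which may vanish. -/
theorem exchange_apply_finsetOpProd {f g : ι → ι → ℂ} {E B : ι → EndH H} {e : ι → ℂ} {v : H}
    (hEB : ∀ x y, x ≠ y → E x * B y = f x y • (B y * E x) - g x y • (B x * E y))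
    (hBB : ∀ x y, x ≠ y → f x y • (B x * B y) = f x y • (B y * B x))
    (hfg : ∀ x y z, x ≠ y → y ≠ z → x ≠ z →
      g x y * g y z - f x y * g x z = -(g x z * f z y))
    (hE : ∀ x, E x v = e x • v) (s : Finset ι) :
    ∀ x ∉ s, E x (finsetOpProd s B v) =
      (e x * ∏ l ∈ s, f x l) • finsetOpProd s B v +
        ∑ k ∈ s, (-(g x k * e k * ∏ l ∈ s.erase k, f k l)) •
          B x (finsetOpProd (s.erase k) B v) := by
  induction s using Finset.induction_on_min with
  | empty => intro x _; simp [finsetOpProd_empty, hE]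
  | insert m s hm ih =>
    intro x hx
    have hms : m ∉ s := fun h => lt_irrefl _ (hm m h)
    rw [Finset.mem_insert, not_or] at hx
    have hsum : ∑ k ∈ s, (-(g x k * e k * ∏ l ∈ (insert m s).erase k, f k l)) •
          B x (finsetOpProd ((insert m s).erase k) B v) =
        f x m • B m (∑ k ∈ s, (-(g x k * e k * ∏ l ∈ s.erase k, f k l)) •
          B x (finsetOpProd (s.erase k) B v)) -
        g x m • B x (∑ k ∈ s, (-(g m k * e k * ∏ l ∈ s.erase k, f k l)) •
          B m (finsetOpProd (s.erase k) B v)) := by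
      rw [map_sum, map_sum, Finset.smul_sum, Finset.smul_sum, ← Finset.sum_sub_distrib]
      refine Finset.sum_congr rfl fun k hk => ?_
      have hmk : m ≠ k := fun h => hms (h ▸ hk)
      have hxk : x ≠ k := fun h => hx.2 (h ▸ hk)
      rw [Finset.erase_insert_of_ne hmk,
        finsetOpProd_insert_min (fun y hy => hm y (Finset.mem_of_mem_erase hy)),
        Finset.prod_insert (fun h => hms (Finset.mem_of_mem_erase h)), Module.End.mul_apply]
      set w := finsetOpProd (s.erase k) B v
      set F := ∏ l ∈ s.erase k, f k l
      have h1 : f x m • B m (B x w) = f x m • B x (B m w) := by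
        have := congrArg (fun Y : EndH H => Y w) (hBB x m hx.1)
        simpa using this.symm
      rw [map_smul, map_smul, smul_comm, h1, smul_smul, smul_smul, ← sub_smul]
      congr 1
      linear_combination (-(e k * F)) * hfg x m k hx.1 hmk hxk
    have h2 := congrArg (fun Y : EndH H => Y (finsetOpProd s B v)) (hEB x m hx.1)
    simp only [Module.End.mul_apply, LinearMap.sub_apply, LinearMap.smul_apply] at h2
    rw [Finset.sum_insert hms, hsum, finsetOpProd_insert_min hm, Finset.prod_insert hms,
      Finset.erase_insert hms, Module.End.mul_apply, h2, ih x hx.2, ih m hms]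
    simp only [map_add, map_smul, smul_add, smul_smul]
    module

/-- Coefficient of `B₁(S) B₂(S')` in the two-component Bethe vector. -/
def splitCoeff (f : ι → ι → ℂ) (a d : ι → ℂ) (S S' : Finset ι) : ℂ :=
  (∏ k ∈ S', a k) * (∏ k ∈ S, d k) * ∏ k ∈ S, ∏ l ∈ S', f k l

theorem splitCoeff_insert_left (f : ι → ι → ℂ) (a d : ι → ℂ) {S S' : Finset ι} {x : ι}
    (hx : x ∉ S) :
    splitCoeff f a d (insert x S) S' = d x * (∏ l ∈ S', f x l) * splitCoeff f a d S S' := by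
  rw [splitCoeff, Finset.prod_insert hx, Finset.prod_insert hx, splitCoeff]
  ring

theorem splitCoeff_insert_right (f : ι → ι → ℂ) (a d : ι → ℂ) {S S' : Finset ι} {x : ι}
    (hx : x ∉ S') :
    splitCoeff f a d S (insert x S') = a x * (∏ k ∈ S, f k x) * splitCoeff f a d S S' := by
  have : ∏ k ∈ S, ∏ l ∈ insert x S', f k l = (∏ k ∈ S, f k x) * ∏ k ∈ S, ∏ l ∈ S', f k l := by
    rw [← Finset.prod_mul_distrib]
    exact Finset.prod_congr rfl fun k _ => Finset.prod_insert hx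
  rw [splitCoeff, Finset.prod_insert hx, this, splitCoeff]
  ring

/-- The terms of the two-component expansion in which a spectral parameter has been exchanged
cancel pairwise. -/
theorem sum_unwanted_eq_zero {f g : ι → ι → ℂ} {a d : ι → ℂ} (hg : ∀ x y, g y x = -g x y)
    (W : Finset ι → Finset ι → H) (s : Finset ι) (x : ι) :
    (∑ S ∈ s.powerset, ∑ k ∈ S, (splitCoeff f a d S (s \ S) *
        (-(g k x * a k * ∏ l ∈ S.erase k, f l k))) • W (S.erase k) (s \ S)) +
      ∑ S ∈ s.powerset, ∑ k ∈ s \ S, (splitCoeff f a d S (s \ S) *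
        (-(g x k * d k * ∏ l ∈ (s \ S).erase k, f k l))) • W S ((s \ S).erase k) = 0 := by
  rw [add_eq_zero_iff_eq_neg, ← Finset.sum_neg_distrib]
  simp_rw [← Finset.sum_neg_distrib]
  rw [Finset.sum_sigma', Finset.sum_sigma']
  refine Finset.sum_bij' (fun p _ => ⟨p.1.erase p.2, p.2⟩) (fun p _ => ⟨insert p.2 p.1, p.2⟩)
    ?_ ?_ ?_ ?_ ?_
  · rintro ⟨S, k⟩ h
    simp only [Finset.mem_sigma, Finset.mem_powerset, Finset.mem_sdiff] at h ⊢
    exact ⟨(Finset.erase_subset _ _).trans h.1, h.1 h.2, Finset.notMem_erase _ _⟩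
  · rintro ⟨S, k⟩ h
    simp only [Finset.mem_sigma, Finset.mem_powerset, Finset.mem_sdiff] at h ⊢
    exact ⟨Finset.insert_subset h.2.1 h.1, Finset.mem_insert_self _ _⟩
  · rintro ⟨S, k⟩ h
    simp only [Finset.mem_sigma] at h
    simp [Finset.insert_erase h.2]
  · rintro ⟨S, k⟩ h
    simp only [Finset.mem_sigma, Finset.mem_sdiff] at h
    simp [Finset.erase_insert h.2.2]
  · rintro ⟨S, k⟩ h
    simp only [Finset.mem_sigma, Finset.mem_powerset] at h
    obtain ⟨hS, hk⟩ := h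
    obtain ⟨R, hkR, rfl⟩ : ∃ R, k ∉ R ∧ S = insert k R :=
      ⟨S.erase k, Finset.notMem_erase _ _, (Finset.insert_erase hk).symm⟩
    obtain ⟨Q, hkQ, hQ⟩ : ∃ Q, k ∉ Q ∧ s \ R = insert k Q := by
      refine ⟨(s \ R).erase k, Finset.notMem_erase _ _, (Finset.insert_erase ?_).symm⟩
      exact Finset.mem_sdiff.2 ⟨hS hk, hkR⟩
    have hQ' : s \ insert k R = Q := by
      rw [Finset.sdiff_insert, hQ, Finset.erase_insert hkQ]
    simp only [Finset.erase_insert hkR, hQ, hQ', Finset.erase_insert hkQ]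
    rw [splitCoeff_insert_left f a d hkR, splitCoeff_insert_right f a d hkQ, hg x k, ← neg_smul]
    congr 1
    ring

/-- The Bethe vector of a two-component model. -/
theorem two_component_apply {f g : ι → ι → ℂ} {A₁ B₁ B₂ D₂ : ι → EndH H} {a d : ι → ℂ} {v : H}
    (hg : ∀ x y, g y x = -g x y)
    (hAB : ∀ x y, x ≠ y → A₁ x * B₁ y = f y x • (B₁ y * A₁ x) - g y x • (B₁ x * A₁ y))
    (hDB : ∀ x y, x ≠ y → D₂ x * B₂ y = f x y • (B₂ y * D₂ x) - g x y • (B₂ x * D₂ y))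
    (hBB₁ : ∀ x y, x ≠ y → f x y • (B₁ x * B₁ y) = f x y • (B₁ y * B₁ x))
    (hBB₂ : ∀ x y, x ≠ y → f x y • (B₂ x * B₂ y) = f x y • (B₂ y * B₂ x))
    (hfg : ∀ x y z, x ≠ y → y ≠ z → x ≠ z →
      g x y * g y z - f x y * g x z = -(g x z * f z y))
    (hfg' : ∀ x y z, x ≠ y → y ≠ z → x ≠ z →
      g y x * g z y - f y x * g z x = -(g z x * f y z))
    (hA : ∀ x, A₁ x v = a x • v) (hD : ∀ x, D₂ x v = d x • v)
    (hABc : ∀ x y, Commute (A₁ x) (B₂ y)) (hBDc : ∀ x y, Commute (B₁ x) (D₂ y))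
    (hBBc : ∀ x y, Commute (B₁ x) (B₂ y)) (s : Finset ι) :
    finsetOpProd s (fun k => A₁ k * B₂ k + B₁ k * D₂ k) v =
      ∑ S ∈ s.powerset, splitCoeff f a d S (s \ S) •
        finsetOpProd S B₁ (finsetOpProd (s \ S) B₂ v) := by
  induction s using Finset.induction_on_min with
  | empty => simp [finsetOpProd_empty, splitCoeff]
  | insert x s hx ih =>
    have hxs : x ∉ s := fun h => lt_irrefl _ (hx x h)
    have hBB₁' : ∀ x y, x ≠ y → f y x • (B₁ x * B₁ y) = f y x • (B₁ y * B₁ x) :=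
      fun x y h => (hBB₁ y x h.symm).symm
    have hswap : ∀ S S' : Finset ι, Commute (finsetOpProd S B₁) (finsetOpProd S' B₂) :=
      fun S S' => commute_finsetOpProd fun k _ =>
        (commute_finsetOpProd fun l _ => (hBBc l k).symm).symm
    have hmul : ∀ {X Y : EndH H}, Commute X Y → ∀ w, X (Y w) = Y (X w) := fun h w =>
      congrArg (fun Z : EndH H => Z w) h.eq
    have key : ∀ S ∈ s.powerset,
        (A₁ x * B₂ x + B₁ x * D₂ x) (finsetOpProd S B₁ (finsetOpProd (s \ S) B₂ v)) =
        (a x * ∏ l ∈ S, f l x) • finsetOpProd S B₁ (finsetOpProd (insert x (s \ S)) B₂ v) +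
        (d x * ∏ l ∈ s \ S, f x l) • finsetOpProd (insert x S) B₁ (finsetOpProd (s \ S) B₂ v) +
        ((∑ k ∈ S, (-(g k x * a k * ∏ l ∈ S.erase k, f l k)) •
          finsetOpProd (insert x (S.erase k)) B₁ (finsetOpProd (insert x (s \ S)) B₂ v)) +
        ∑ k ∈ s \ S, (-(g x k * d k * ∏ l ∈ (s \ S).erase k, f k l)) •
          finsetOpProd (insert x S) B₁ (finsetOpProd (insert x ((s \ S).erase k)) B₂ v)) := by
      intro S hS
      rw [Finset.mem_powerset] at hS
      have hS1 : ∀ y ∈ S, x < y := fun y hy => hx y (hS hy)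
      have hS2 : ∀ y ∈ s \ S, x < y := fun y hy => hx y (Finset.mem_sdiff.1 hy).1
      have e1 := exchange_apply_finsetOpProd (f := fun x y => f y x) (g := fun x y => g y x)
        hAB hBB₁' hfg' hA S x (fun h => hxs (hS h))
      have e2 := exchange_apply_finsetOpProd hDB hBB₂ hfg hD (s \ S) x
        (fun h => hxs (Finset.mem_sdiff.1 h).1)
      have t1 : (A₁ x * B₂ x) (finsetOpProd S B₁ (finsetOpProd (s \ S) B₂ v)) =
          finsetOpProd (insert x (s \ S)) B₂ (A₁ x (finsetOpProd S B₁ v)) := by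
        rw [finsetOpProd_insert_min hS2, hmul (hswap _ _), Module.End.mul_apply,
          Module.End.mul_apply, hmul (hABc x x),
          hmul (commute_finsetOpProd fun k _ => hABc x k)]
      have t2 : (B₁ x * D₂ x) (finsetOpProd S B₁ (finsetOpProd (s \ S) B₂ v)) =
          finsetOpProd (insert x S) B₁ (D₂ x (finsetOpProd (s \ S) B₂ v)) := by
        rw [finsetOpProd_insert_min hS1, Module.End.mul_apply, Module.End.mul_apply,
          hmul (commute_finsetOpProd fun k _ => (hBDc k x).symm)]
      rw [LinearMap.add_apply, t1, t2, e1, e2, map_add, map_add, map_sum, map_sum, map_smul,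
        map_smul, ← hmul (hswap _ _)]
      have r1 : ∀ k ∈ S, finsetOpProd (insert x (s \ S)) B₂
          ((-(g k x * a k * ∏ l ∈ S.erase k, f l k)) • B₁ x (finsetOpProd (S.erase k) B₁ v)) =
          (-(g k x * a k * ∏ l ∈ S.erase k, f l k)) •
          finsetOpProd (insert x (S.erase k)) B₁ (finsetOpProd (insert x (s \ S)) B₂ v) := by
        intro k _
        rw [map_smul, hmul (hswap _ _),
          finsetOpProd_insert_min fun y hy => hS1 y (Finset.mem_of_mem_erase hy),
          Module.End.mul_apply]
      have r2 : ∀ k ∈ s \ S, finsetOpProd (insert x S) B₁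
          ((-(g x k * d k * ∏ l ∈ (s \ S).erase k, f k l)) •
            B₂ x (finsetOpProd ((s \ S).erase k) B₂ v)) =
          (-(g x k * d k * ∏ l ∈ (s \ S).erase k, f k l)) •
          finsetOpProd (insert x S) B₁ (finsetOpProd (insert x ((s \ S).erase k)) B₂ v) := by
        intro k _
        rw [map_smul, finsetOpProd_insert_min fun y hy => hS2 y (Finset.mem_of_mem_erase hy),
          Module.End.mul_apply]
      rw [Finset.sum_congr rfl r1, Finset.sum_congr rfl r2]
      abel
    have hcancel := sum_unwanted_eq_zero (f := f) (a := a) (d := d) hg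
      (fun R Q => finsetOpProd (insert x R) B₁ (finsetOpProd (insert x Q) B₂ v)) s x
    rw [finsetOpProd_insert_min hx, Module.End.mul_apply, ih, map_sum,
      Finset.sum_powerset_insert hxs]
    simp only [map_smul]
    rw [Finset.sum_congr rfl fun S hS => by rw [key S hS]]
    simp only [smul_add, Finset.sum_add_distrib, Finset.smul_sum, smul_smul]
    rw [hcancel, add_zero]
    congr 1
    · refine Finset.sum_congr rfl fun S hS => ?_
      have hxS : x ∉ S := fun h => hxs (Finset.mem_powerset.1 hS h)
      rw [Finset.insert_sdiff_of_notMem _ hxS,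
        splitCoeff_insert_right f a d (fun h => hxs (Finset.mem_sdiff.1 h).1)]
      congr 1
      ring
    · refine Finset.sum_congr rfl fun S hS => ?_
      have hxS : x ∉ S := fun h => hxs (Finset.mem_powerset.1 hS h)
      have : insert x s \ insert x S = s \ S := by
        rw [Finset.insert_sdiff_insert, Finset.sdiff_insert_of_notMem hxs]
      rw [this, splitCoeff_insert_left f a d hxS]
      congr 1
      ring

end OperatorProducts

section Monodromy

theorem aux1_mul (S T : Matrix (Fin 2) (Fin 2) (EndH H)) :
    aux1 (S * T) = aux1 S * aux1 T := by
  ext1 p q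
  obtain ⟨p1, p2⟩ := p
  obtain ⟨q1, q2⟩ := q
  fin_cases p2 <;> fin_cases q2 <;>
    simp [aux1, Matrix.mul_apply, Fintype.sum_prod_type]

theorem aux2_mul (S T : Matrix (Fin 2) (Fin 2) (EndH H)) :
    aux2 (S * T) = aux2 S * aux2 T := by
  ext1 p q
  obtain ⟨p1, p2⟩ := p
  obtain ⟨q1, q2⟩ := q
  fin_cases p1 <;> fin_cases q1 <;>
    simp [aux2, Matrix.mul_apply, Fintype.sum_prod_type]

theorem aux1_mul_aux2_comm {S T : Matrix (Fin 2) (Fin 2) (EndH H)}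
    (h : ∀ a b c d, Commute (S a b) (T c d)) : aux1 S * aux2 T = aux2 T * aux1 S := by
  ext1 p q
  obtain ⟨p1, p2⟩ := p
  obtain ⟨q1, q2⟩ := q
  have := (h p1 q1 p2 q2).eq
  simp [aux1, aux2, Matrix.mul_apply, Fintype.sum_prod_type, this]

/-- A monodromy matrix with vacuum `v` and vacuum eigenvalues `a`, `d`. -/
structure IsVacuumMonodromy (Λ : Set ℂ) (eta : ℂ) (v : H)
    (T : ℂ → Matrix (Fin 2) (Fin 2) (EndH H)) (a d : ℂ → ℂ) : Prop where
  rtt : SatisfiesRTT Λ (fun lam mu => Complex.sinh (lam - mu) ≠ 0) (RXXZ eta) T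
  apply_A : ∀ lam ∈ Λ, T lam 0 0 v = a lam • v
  apply_D : ∀ lam ∈ Λ, T lam 1 1 v = d lam • v
  apply_C : ∀ lam ∈ Λ, T lam 1 0 v = 0

/-- All entries of `S lam` commute with all entries of `T mu`. -/
def EntriesCommute (Λ : Set ℂ) (S T : ℂ → Matrix (Fin 2) (Fin 2) (EndH H)) : Prop :=
  ∀ lam ∈ Λ, ∀ mu ∈ Λ, ∀ a b c d : Fin 2, Commute (S lam a b) (T mu c d)

variable {Λ : Set ℂ} {eta : ℂ} {v : H}

theorem IsVacuumMonodromy.one :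
    IsVacuumMonodromy (H := H) Λ eta v (fun _ => 1) (fun _ => 1) (fun _ => 1) where
  rtt := by
    intro lam mu _ _ _
    have h1 : aux1 (1 : Matrix (Fin 2) (Fin 2) (EndH H)) = 1 := by
      ext1 p q
      obtain ⟨p1, p2⟩ := p
      obtain ⟨q1, q2⟩ := q
      fin_cases p1 <;> fin_cases p2 <;> fin_cases q1 <;> fin_cases q2 <;> simp [aux1]
    have h2 : aux2 (1 : Matrix (Fin 2) (Fin 2) (EndH H)) = 1 := by
      ext1 p q
      obtain ⟨p1, p2⟩ := p
      obtain ⟨q1, q2⟩ := q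
      fin_cases p1 <;> fin_cases p2 <;> fin_cases q1 <;> fin_cases q2 <;> simp [aux2]
    simp [h1, h2]
  apply_A := by simp
  apply_D := by simp
  apply_C := by simp

theorem IsVacuumMonodromy.mul {S T : ℂ → Matrix (Fin 2) (Fin 2) (EndH H)} {a d a' d' : ℂ → ℂ}
    (hS : IsVacuumMonodromy Λ eta v S a d) (hT : IsVacuumMonodromy Λ eta v T a' d')
    (h : EntriesCommute Λ S T) :
    IsVacuumMonodromy Λ eta v (fun lam => S lam * T lam) (fun lam => a lam * a' lam)
      (fun lam => d lam * d' lam) where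
  rtt := by
    intro lam mu hlam hmu hadm
    have e1 := hS.rtt lam mu hlam hmu hadm
    have e2 := hT.rtt lam mu hlam hmu hadm
    have c1 : aux1 (T lam) * aux2 (S mu) = aux2 (S mu) * aux1 (T lam) :=
      aux1_mul_aux2_comm fun p q r s => (h mu hmu lam hlam r s p q).symm
    have c2 : aux1 (S lam) * aux2 (T mu) = aux2 (T mu) * aux1 (S lam) :=
      aux1_mul_aux2_comm (h lam hlam mu hmu)
    rw [aux1_mul, aux2_mul]
    generalize embedR (H := H) (RXXZ eta lam mu) = R at *
    calc R * (aux1 (S lam) * aux1 (T lam)) * (aux2 (S mu) * aux2 (T mu))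
        = R * aux1 (S lam) * (aux1 (T lam) * aux2 (S mu)) * aux2 (T mu) := by noncomm_ring
      _ = R * aux1 (S lam) * aux2 (S mu) * aux1 (T lam) * aux2 (T mu) := by
        rw [c1]; noncomm_ring
      _ = aux2 (S mu) * aux1 (S lam) * (R * aux1 (T lam) * aux2 (T mu)) := by
        rw [e1]; noncomm_ring
      _ = aux2 (S mu) * (aux1 (S lam) * aux2 (T mu)) * aux1 (T lam) * R := by
        rw [e2]; noncomm_ring
      _ = aux2 (S mu) * aux2 (T mu) * (aux1 (S lam) * aux1 (T lam)) * R := by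
        rw [c2]; noncomm_ring
  apply_A := by
    intro lam hlam
    simp [Matrix.mul_apply, hT.apply_A lam hlam, hT.apply_C lam hlam, hS.apply_A lam hlam,
      smul_smul, mul_comm]
  apply_D := by
    intro lam hlam
    have hc := congrArg (fun Z : EndH H => Z v) (h lam hlam lam hlam 1 0 0 1).eq
    simp only [Module.End.mul_apply] at hc
    simp [Matrix.mul_apply, hT.apply_D lam hlam, hS.apply_D lam hlam, hc, hS.apply_C lam hlam,
      smul_smul, mul_comm]
  apply_C := by
    intro lam hlam
    simp [Matrix.mul_apply, hT.apply_A lam hlam, hT.apply_C lam hlam, hS.apply_C lam hlam]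

theorem EntriesCommute.mul_right {R S T : ℂ → Matrix (Fin 2) (Fin 2) (EndH H)}
    (hS : EntriesCommute Λ R S) (hT : EntriesCommute Λ R T) :
    EntriesCommute Λ R (fun lam => S lam * T lam) := by
  intro lam hlam mu hmu a b c d
  simp only [Matrix.mul_apply]
  exact Commute.sum_right _ _ _ fun k _ =>
    (hS lam hlam mu hmu _ _ _ _).mul_right (hT lam hlam mu hmu _ _ _ _)

theorem EntriesCommute.list_prod_right {R : ℂ → Matrix (Fin 2) (Fin 2) (EndH H)} {K : ℕ}
    {T : Fin K → ℂ → Matrix (Fin 2) (Fin 2) (EndH H)} (h : ∀ j, EntriesCommute Λ R (T j)) :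
    EntriesCommute Λ R (fun lam => (List.ofFn fun j => T j lam).prod) := by
  induction K with
  | zero =>
    intro lam _ mu _ a b c d
    by_cases hcd : c = d <;> simp [hcd]
  | succ K ih =>
    simp only [List.ofFn_succ, List.prod_cons]
    exact (h 0).mul_right (ih fun j => h j.succ)

theorem IsVacuumMonodromy.list_prod {K : ℕ} {T : Fin K → ℂ → Matrix (Fin 2) (Fin 2) (EndH H)}
    {a d : Fin K → ℂ → ℂ} (hT : ∀ j, IsVacuumMonodromy Λ eta v (T j) (a j) (d j))
    (hc : ∀ i j, i ≠ j → EntriesCommute Λ (T i) (T j)) :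
    IsVacuumMonodromy Λ eta v (fun lam => (List.ofFn fun j => T j lam).prod)
      (fun lam => ∏ j, a j lam) (fun lam => ∏ j, d j lam) := by
  induction K with
  | zero => simpa using IsVacuumMonodromy.one
  | succ K ih =>
    simp only [List.ofFn_succ, List.prod_cons, Fin.prod_univ_succ]
    exact (hT 0).mul
      (ih (fun j => hT j.succ) fun i j hij => hc _ _ fun h => hij (Fin.succ_injective _ h))
      (EntriesCommute.list_prod_right fun j => hc _ _ (Fin.succ_ne_zero j).symm)

section Exchange

variable {T : ℂ → Matrix (Fin 2) (Fin 2) (EndH H)}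
  {x y : ℂ}

theorem gXXZ_swap (eta x y : ℂ) : gXXZ eta y x = -gXXZ eta x y := by
  rw [gXXZ, gXXZ, ← neg_sub x y, Complex.sinh_neg, div_neg]

theorem D_mul_B
    (hT : SatisfiesRTT Λ (fun lam mu => Complex.sinh (lam - mu) ≠ 0) (RXXZ eta) T)
    (hx : x ∈ Λ) (hy : y ∈ Λ) (h : Complex.sinh (x - y) ≠ 0) :
    T x 1 1 * T y 0 1 =
      fXXZ eta x y • (T y 0 1 * T x 1 1) - gXXZ eta x y • (T x 0 1 * T y 1 1) := by
  have := congrFun (congrFun (hT x y hx hy h) (1, 0)) (1, 1)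
  simp [embedR, aux1, aux2, RXXZ, Rfg, Matrix.mul_apply, Fintype.sum_prod_type] at this
  rw [← this]
  abel

theorem A_mul_B
    (hT : SatisfiesRTT Λ (fun lam mu => Complex.sinh (lam - mu) ≠ 0) (RXXZ eta) T)
    (hx : x ∈ Λ) (hy : y ∈ Λ) (h : Complex.sinh (y - x) ≠ 0) :
    T x 0 0 * T y 0 1 =
      fXXZ eta y x • (T y 0 1 * T x 0 0) - gXXZ eta y x • (T x 0 1 * T y 0 0) := by
  have := congrFun (congrFun (hT y x hy hx h) (0, 0)) (1, 0)
  simp [embedR, aux1, aux2, RXXZ, Rfg, Matrix.mul_apply, Fintype.sum_prod_type] at this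
  rw [this]
  abel

theorem smul_B_mul_B
    (hT : SatisfiesRTT Λ (fun lam mu => Complex.sinh (lam - mu) ≠ 0) (RXXZ eta) T)
    (hx : x ∈ Λ) (hy : y ∈ Λ) (h : Complex.sinh (x - y) ≠ 0) :
    fXXZ eta x y • (T x 0 1 * T y 0 1) = fXXZ eta x y • (T y 0 1 * T x 0 1) := by
  have := congrFun (congrFun (hT x y hx hy h) (0, 0)) (1, 1)
  simpa [embedR, aux1, aux2, RXXZ, Rfg, Matrix.mul_apply, Fintype.sum_prod_type] using this

theorem gXXZ_mul_gXXZ {x y z : ℂ} (hxy : Complex.sinh (x - y) ≠ 0)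
    (hyz : Complex.sinh (y - z) ≠ 0) (hxz : Complex.sinh (x - z) ≠ 0) :
    gXXZ eta x y * gXXZ eta y z - fXXZ eta x y * gXXZ eta x z =
      -(gXXZ eta x z * fXXZ eta z y) := by
  obtain ⟨u, rfl⟩ : ∃ u, x = y + u := ⟨x - y, by ring⟩
  obtain ⟨w, rfl⟩ : ∃ w, y = z + w := ⟨y - z, by ring⟩
  have e1 : z + w + u - (z + w) = u := by ring
  have e2 : z + w - z = w := by ring
  have e3 : z + w + u - z = w + u := by ring
  have e4 : z - (z + w) = -w := by ring
  rw [e1] at hxy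
  rw [e2] at hyz
  rw [e3] at hxz
  simp only [gXXZ, fXXZ, e1, e2, e3, e4, Complex.sinh_neg]
  field_simp
  simp only [neg_add_eq_sub, Complex.sinh_sub, Complex.sinh_add]
  ring

theorem gXXZ_mul_gXXZ_symm {x y z : ℂ} (hxy : Complex.sinh (x - y) ≠ 0)
    (hyz : Complex.sinh (y - z) ≠ 0) (hxz : Complex.sinh (x - z) ≠ 0) :
    gXXZ eta y x * gXXZ eta z y - fXXZ eta y x * gXXZ eta z x =
      -(gXXZ eta z x * fXXZ eta y z) := by
  have h := gXXZ_mul_gXXZ (eta := eta) (x := -x) (y := -y) (z := -z)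
    (by rwa [neg_sub_neg, ← neg_sub, Complex.sinh_neg, neg_ne_zero])
    (by rwa [neg_sub_neg, ← neg_sub, Complex.sinh_neg, neg_ne_zero])
    (by rwa [neg_sub_neg, ← neg_sub, Complex.sinh_neg, neg_ne_zero])
  simpa only [gXXZ, fXXZ, neg_sub_neg] using h

end Exchange

end Monodromy

section PartitionSum

theorem prod_lt_pairs_succ {K : ℕ} (F : Fin (K + 1) → Fin (K + 1) → ℂ) :
    ∏ i, ∏ j ∈ Finset.univ.filter (fun j => i < j), F i j =
      (∏ j : Fin K, F 0 j.succ) *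
        ∏ i : Fin K, ∏ j ∈ Finset.univ.filter (fun j => i < j), F i.succ j.succ := by
  simp [Finset.prod_filter, Fin.prod_univ_succ]

variable {ι : Type} [Fintype ι] [LinearOrder ι]

/-- Coefficient of an ordered partition, encoded as the map `P` sending an index to its part. -/
def partitionCoeff {K : ℕ} (f : ι → ι → ℂ) (a d : Fin K → ι → ℂ) (P : ι → Fin K) : ℂ :=
  ∏ i : Fin K, ∏ j ∈ Finset.univ.filter (fun j : Fin K => i < j),
    ((∏ k ∈ Finset.univ.filter (fun k => P k = j), a i k) *
      (∏ k ∈ Finset.univ.filter (fun k => P k = i), d j k) *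
      (∏ k ∈ Finset.univ.filter (fun k => P k = i),
        ∏ l ∈ Finset.univ.filter (fun l => P l = j), f k l))

/-- Ordered product of creation operators attached to an ordered partition. -/
def partitionOp {K : ℕ} (B : Fin K → ι → EndH H) (P : ι → Fin K) : EndH H :=
  (List.ofFn fun j => finsetOpProd (Finset.univ.filter fun k => P k = j) (B j)).prod

/-- Extend a partition of `s` by the complement of `s` as a new first part. -/
def extendPartition {K : ℕ} (s : Finset ι) (Q : s → Fin K) (k : ι) : Fin (K + 1) :=
  if h : k ∈ s then (Q ⟨k, h⟩).succ else 0

theorem filter_extendPartition_zero {K : ℕ} (s : Finset ι) (Q : s → Fin K) :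
    Finset.univ.filter (fun k => extendPartition s Q k = 0) = Finset.univ \ s := by
  ext k
  by_cases h : k ∈ s <;> simp [extendPartition, h]

theorem filter_extendPartition_succ {K : ℕ} (s : Finset ι) (Q : s → Fin K) (j : Fin K) :
    Finset.univ.filter (fun k => extendPartition s Q k = j.succ) =
      (Finset.univ.filter fun k => Q k = j).map (Function.Embedding.subtype _) := by
  ext k
  rw [Finset.mem_filter_univ, extendPartition]
  by_cases h : k ∈ s <;> simp [h, (Fin.succ_ne_zero j).symm]

theorem prod_prod_fiber {κ : Type} [Fintype κ] {K : ℕ} (Q : κ → Fin K) (c : κ → ℂ) :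
    ∏ j, ∏ k ∈ Finset.univ.filter (fun k => Q k = j), c k = ∏ k, c k :=
  Finset.prod_fiberwise _ _ _

theorem partitionCoeff_extend {K : ℕ} (f : ι → ι → ℂ) (a d : Fin (K + 1) → ι → ℂ)
    (s : Finset ι) (Q : s → Fin K) :
    partitionCoeff f a d (extendPartition s Q) =
      splitCoeff f (a 0) (fun k => ∏ j : Fin K, d j.succ k) (Finset.univ \ s) s *
        partitionCoeff (fun k l : s => f k l) (fun j k => a j.succ k) (fun j k => d j.succ k)
          Q := by
  rw [partitionCoeff, prod_lt_pairs_succ]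
  simp only [filter_extendPartition_zero, filter_extendPartition_succ, Finset.prod_map,
    Function.Embedding.subtype_apply]
  rw [partitionCoeff]
  congr 1
  rw [Finset.prod_mul_distrib, Finset.prod_mul_distrib, prod_prod_fiber, splitCoeff]
  congr 1
  · rw [Finset.prod_coe_sort, Finset.prod_comm]
  · rw [Finset.prod_comm]
    refine Finset.prod_congr rfl fun k _ => ?_
    rw [prod_prod_fiber Q fun l => f k l, Finset.prod_coe_sort s (f k)]

theorem partitionOp_extend {K : ℕ} (B : Fin (K + 1) → ι → EndH H) (s : Finset ι)
    (Q : s → Fin K) :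
    partitionOp B (extendPartition s Q) =
      finsetOpProd (Finset.univ \ s) (B 0) * partitionOp (fun j (k : s) => B j.succ k) Q := by
  rw [partitionOp, List.ofFn_succ, List.prod_cons, filter_extendPartition_zero, partitionOp]
  congr 3
  funext j
  rw [filter_extendPartition_succ, finsetOpProd_map _ (Subtype.strictMono_coe _)]
  rfl

theorem sum_partition_succ {V : Type} [AddCommMonoid V] {K : ℕ} (F : (ι → Fin (K + 1)) → V) :
    ∑ P, F P = ∑ S ∈ (Finset.univ : Finset ι).powerset,
      ∑ Q : ↥(Finset.univ \ S) → Fin K, F (extendPartition (Finset.univ \ S) Q) := by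
  rw [← Finset.sum_fiberwise_of_maps_to (s := Finset.univ)
    (t := (Finset.univ : Finset ι).powerset)
    (g := fun P : ι → Fin (K + 1) => Finset.univ.filter fun k => P k = 0) (by simp)]
  refine Finset.sum_congr rfl fun S _ => ?_
  symm
  refine Finset.sum_bij (fun Q _ => extendPartition _ Q) ?_ ?_ ?_ fun _ _ => rfl
  · intro Q _
    rw [Finset.mem_filter]
    exact ⟨Finset.mem_univ _, by rw [filter_extendPartition_zero]; simp⟩
  · intro Q _ Q' _ h
    funext k
    have := congrFun h k
    simpa [extendPartition, (Finset.mem_sdiff.1 k.2).2] using this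
  · intro P hP
    rw [Finset.mem_filter] at hP
    have hS : ∀ k, P k = 0 ↔ k ∈ S := fun k => by simp [← hP.2]
    refine ⟨fun k => (P k).pred fun h => (Finset.mem_sdiff.1 k.2).2 ((hS k).1 h),
      Finset.mem_univ _, ?_⟩
    funext k
    by_cases hk : k ∈ S
    · simp [extendPartition, hk, (hS k).2 hk]
    · simp [extendPartition, hk]

end PartitionSum

/-- The Bethe vector of a product of commuting monodromy matrices, with spectral parameters indexed
by an arbitrary finite linear order. -/
theorem finsetOpProd_prod_apply_eq_sum {Λ : Set ℂ} {eta : ℂ} {v : H} {K : ℕ} :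
    ∀ {T : Fin K → ℂ → Matrix (Fin 2) (Fin 2) (EndH H)} {a d : Fin K → ℂ → ℂ}
      (_ : ∀ j, IsVacuumMonodromy Λ eta v (T j) (a j) (d j))
      (_ : ∀ i j, i ≠ j → EntriesCommute Λ (T i) (T j))
      {ι : Type} [Fintype ι] [LinearOrder ι] (lam : ι → ℂ) (_ : ∀ i, lam i ∈ Λ)
      (_ : ∀ j k, j ≠ k → Complex.sinh (lam j - lam k) ≠ 0),
      finsetOpProd Finset.univ (fun i => (List.ofFn fun j => T j (lam i)).prod 0 1) v =
        ∑ P : ι → Fin K,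
          partitionCoeff (fun k l => fXXZ eta (lam k) (lam l)) (fun j k => a j (lam k))
            (fun j k => d j (lam k)) P •
          partitionOp (fun j k => T j (lam k) 0 1) P v := by
  induction K with
  | zero =>
    intro T a d _ _ ι _ _ lam _ _
    rcases isEmpty_or_nonempty ι with hι | ⟨⟨x⟩⟩
    · simp [Finset.univ_eq_empty, finsetOpProd_empty, partitionCoeff, partitionOp]
    · have : IsEmpty (ι → Fin 0) := ⟨fun P => (P x).elim0⟩
      have h0 : finsetOpProd (H := H) (Finset.univ : Finset ι) (fun _ => 0) = 0 := by
        rw [finsetOpProd]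
        exact List.prod_eq_zero (List.mem_map.2 ⟨x, by simp, rfl⟩)
      simp [h0]
  | succ K ih =>
    intro T a d hT hc ι _ _ lam hlam hdist
    have hT' := IsVacuumMonodromy.list_prod (fun j : Fin K => hT j.succ)
      fun i j hij => hc _ _ fun h => hij (Fin.succ_injective _ h)
    have hc' := EntriesCommute.list_prod_right fun j : Fin K =>
      hc 0 j.succ (Fin.succ_ne_zero j).symm
    have htwo := two_component_apply (f := fun k l => fXXZ eta (lam k) (lam l))
      (g := fun k l => gXXZ eta (lam k) (lam l)) (A₁ := fun k => T 0 (lam k) 0 0)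
      (B₁ := fun k => T 0 (lam k) 0 1)
      (B₂ := fun k => (List.ofFn fun j : Fin K => T j.succ (lam k)).prod 0 1)
      (D₂ := fun k => (List.ofFn fun j : Fin K => T j.succ (lam k)).prod 1 1)
      (a := fun k => a 0 (lam k)) (d := fun k => ∏ j : Fin K, d j.succ (lam k)) (v := v)
      (fun x y => gXXZ_swap _ _ _)
      (fun x y h => A_mul_B (hT 0).rtt (hlam x) (hlam y) (hdist y x h.symm))
      (fun x y h => D_mul_B hT'.rtt (hlam x) (hlam y) (hdist x y h))
      (fun x y h => smul_B_mul_B (hT 0).rtt (hlam x) (hlam y) (hdist x y h))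
      (fun x y h => smul_B_mul_B hT'.rtt (hlam x) (hlam y) (hdist x y h))
      (fun x y z hxy hyz hxz => gXXZ_mul_gXXZ (hdist x y hxy) (hdist y z hyz) (hdist x z hxz))
      (fun x y z hxy hyz hxz => gXXZ_mul_gXXZ_symm (hdist x y hxy) (hdist y z hyz)
        (hdist x z hxz))
      (fun x => (hT 0).apply_A _ (hlam x)) (fun x => hT'.apply_D _ (hlam x))
      (fun x y => hc' _ (hlam x) _ (hlam y) _ _ _ _)
      (fun x y => hc' _ (hlam x) _ (hlam y) _ _ _ _)
      (fun x y => hc' _ (hlam x) _ (hlam y) _ _ _ _) Finset.univ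
    simp only [List.ofFn_succ, List.prod_cons, Matrix.mul_apply, Fin.sum_univ_two]
    rw [htwo, sum_partition_succ]
    refine Finset.sum_congr rfl fun S _ => ?_
    have hSS : Finset.univ \ (Finset.univ \ S) = S := by simp
    rw [← finsetOpProd_univ_coe (Finset.univ \ S), ih (fun j => hT j.succ)
      (fun i j hij => hc _ _ fun h => hij (Fin.succ_injective _ h))
      (fun k : ↥(Finset.univ \ S) => lam k) (fun k => hlam k)
      (fun j k hjk => hdist j k fun h => hjk (Subtype.ext h)), map_sum, Finset.smul_sum]
    refine Finset.sum_congr rfl fun Q _ => ?_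
    rw [partitionCoeff_extend, partitionOp_extend, hSS, map_smul, smul_smul, Module.End.mul_apply]

/-- multi-component model, XXZ case: the formal Bethe vector of the
full model expressed via its `K` components.  Ordered partitions `(J₁, …, J_K)` of
`{1,…,M}` are encoded as maps `P : Fin M → Fin K`, with `Jⱼ = P⁻¹(j)`. -/
theorem multi_component_Bethe_vectors_XXZ {H : Type} [AddCommGroup H] [Module ℂ H]
    (eta : ℂ) (K : ℕ) (hK : 1 ≤ K) (Λ : Set ℂ)
    (T : Fin K → ℂ → Matrix (Fin 2) (Fin 2) (EndH H))
    (hRTT : ∀ j : Fin K, SatisfiesRTT Λ (fun lam mu => Complex.sinh (lam - mu) ≠ 0) (RXXZ eta) (T j))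
    (hcomm : ∀ i j : Fin K, i ≠ j → ∀ lam mu : ℂ, lam ∈ Λ → mu ∈ Λ →
      ∀ a b c d : Fin 2, Commute (T i lam a b) (T j mu c d))
    (v0 : H) (hv0 : v0 ≠ 0) (a d : Fin K → ℂ → ℂ)
    (hA : ∀ (j : Fin K) (lam : ℂ), lam ∈ Λ → T j lam 0 0 v0 = a j lam • v0)
    (hD : ∀ (j : Fin K) (lam : ℂ), lam ∈ Λ → T j lam 1 1 v0 = d j lam • v0)
    (hC : ∀ (j : Fin K) (lam : ℂ), lam ∈ Λ → T j lam 1 0 v0 = 0)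
    (M : ℕ) (lam : Fin M → ℂ) (hlam : ∀ i, lam i ∈ Λ)
    (hdist : ∀ j k : Fin M, j ≠ k → Complex.sinh (lam j - lam k) ≠ 0) :
    ((List.ofFn (fun i : Fin M =>
        (List.ofFn (fun j : Fin K => T j (lam i))).prod 0 1)).prod) v0
      = ∑ P : Fin M → Fin K,
          ((∏ i : Fin K, ∏ j ∈ Finset.univ.filter (fun j : Fin K => i < j),
              ((∏ k ∈ Finset.univ.filter (fun k : Fin M => P k = j), a i (lam k)) *
                (∏ k ∈ Finset.univ.filter (fun k : Fin M => P k = i), d j (lam k)) *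
                (∏ k ∈ Finset.univ.filter (fun k : Fin M => P k = i),
                  ∏ l ∈ Finset.univ.filter (fun l : Fin M => P l = j),
                    (fXXZ eta) (lam k) (lam l)))) •
            (((List.ofFn (fun j : Fin K =>
                finsetOpProd (Finset.univ.filter (fun k : Fin M => P k = j))
                  (fun k => T j (lam k) 0 1))).prod) v0)) := by
  have h := finsetOpProd_prod_apply_eq_sum (v := v0)
    (fun j => ⟨hRTT j, hA j, hD j, hC j⟩)
    (fun i j hij lam hlam mu hmu => hcomm i j hij lam mu hlam hmu) lam hlam hdist
  rw [finsetOpProd, Fin.sort_univ, ← List.ofFn_eq_map] at h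
  exact h

end
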